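/- (Hough's negative solution to the Minimum Modulus Problem.) Every covering system of the integers with distinct moduli has a modulus at most 10^{16}. That is, if S is a finite set of integers greater than 1, a : S → ℤ, and the union of the classes a_m mod m over m ∈ S equals ℤ, then min S ≤ 10^{16}. -/

import Mathlib

section

open Finset

/-- Reweighting a uniform fibre away from a subset `B`, never by more than a factor `4 / 3`. -/
theorem exists_fibre_density {ι : Type*} [DecidableEq ι] {Y B : Finset ι} (hY : Y.Nonempty)
    (hB : B ⊆ Y) :
    ∃ g : ι → ℝ, (∀ y, 0 ≤ g y) ∧ (∀ y, g y ≤ 4 / 3) ∧ ∑ y ∈ Y, g y = #Y ∧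
      ∑ y ∈ B, g y ≤ 4 / 3 * ((#B : ℝ) / #Y) ^ 2 * #Y := by
  have hY0 : (0 : ℝ) < #Y := by exact_mod_cast hY.card_pos
  obtain ⟨α, hα⟩ : ∃ α : ℝ, (#B : ℝ) / #Y = α := ⟨_, rfl⟩
  have hBα : (#B : ℝ) = α * #Y := by rw [← hα, div_mul_cancel₀ _ hY0.ne']
  rw [hα]
  have hα0 : 0 ≤ α := by rw [← hα]; positivity
  have hα1 : α ≤ 1 := by
    rw [← hα, div_le_one hY0]; exact_mod_cast card_le_card hB
  have hsum (u v : ℝ) : ∑ y ∈ Y, (if y ∈ B then u else v) = (α * u + (1 - α) * v) * #Y := by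
    have h1 : Y.filter (· ∈ B) = B := by
      rw [filter_mem_eq_inter, inter_eq_right.mpr hB]
    have h2 : (#(Y.filter (· ∉ B)) : ℝ) = #Y - #B := by
      have := card_filter_add_card_filter_not (s := Y) (· ∈ B)
      rw [h1] at this
      rw [eq_sub_iff_add_eq, ← this]; push_cast; ring
    rw [sum_ite, sum_const, sum_const, h1, nsmul_eq_mul, nsmul_eq_mul, h2, hBα]; ring
  have hsumB (u v : ℝ) : ∑ y ∈ B, (if y ∈ B then u else v) = α * u * #Y := by
    rw [sum_congr rfl fun y hy => if_pos hy, sum_const, nsmul_eq_mul, hBα]; ring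
  clear hα hBα
  rcases le_or_gt α (1 / 4) with h | h
  · have h1 : (0 : ℝ) < 1 - α := by linarith
    refine ⟨fun y => if y ∈ B then 0 else 1 / (1 - α), fun y => ?_, fun y => ?_, ?_, ?_⟩
    · dsimp only
      split_ifs <;> positivity
    · dsimp only
      split_ifs
      · norm_num
      · rw [div_le_div_iff₀ h1 (by norm_num)]; linarith
    · rw [hsum]; field_simp; ring
    · rw [hsumB]; simp only [mul_zero, zero_mul]; positivity
  · have h0 : (0 : ℝ) < α := by linarith
    refine ⟨fun y => if y ∈ B then (4 / 3) * (α - 1 / 4) / α else 4 / 3,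
      fun y => ?_, fun y => ?_, ?_, ?_⟩
    · dsimp only
      split_ifs
      · exact div_nonneg (by linarith) h0.le
      · norm_num
    · dsimp only
      split_ifs
      · rw [div_le_iff₀ h0]; linarith
      · exact le_rfl
    · rw [hsum]; field_simp; ring
    · rw [hsumB, mul_div_cancel₀ _ h0.ne']
      gcongr
      nlinarith [sq_nonneg (2 * α - 1)]

theorem sum_range_mul_of_coprime {β : Type*} [AddCommMonoid β] {M q : ℕ} (h : M.Coprime q)
    (hM : 0 < M) (hq : 0 < q) (F : ℕ → ℕ → β) :
    ∑ z ∈ range (M * q), F (z % M) (z % q) = ∑ x ∈ range M, ∑ y ∈ range q, F x y := by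
  rw [← sum_product' (range M) (range q) F]
  refine sum_nbij' (fun z => (z % M, z % q)) (fun p => ((Nat.chineseRemainder h p.1 p.2 : ℕ)))
    ?_ ?_ ?_ ?_ ?_
  · intro z _
    simp [Nat.mod_lt, hM, hq]
  · intro p _
    exact mem_range.mpr (Nat.chineseRemainder_lt_mul h _ _ hM.ne' hq.ne')
  · intro z hz
    have hc := (Nat.chineseRemainder h (z % M) (z % q)).2
    have : (Nat.chineseRemainder h (z % M) (z % q) : ℕ) ≡ z [MOD M * q] :=
      (Nat.modEq_and_modEq_iff_modEq_mul h).mp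
        ⟨hc.1.trans (Nat.mod_modEq _ _), hc.2.trans (Nat.mod_modEq _ _)⟩
    exact this.eq_of_lt_of_lt (Nat.chineseRemainder_lt_mul h _ _ hM.ne' hq.ne') (mem_range.mp hz)
  · intro p hp
    simp only [mem_product, mem_range] at hp
    have hc := (Nat.chineseRemainder h p.1 p.2).2
    ext
    · exact Nat.mod_eq_of_modEq hc.1 hp.1
    · exact Nat.mod_eq_of_modEq hc.2 hp.2
  · intro z _; rfl

theorem card_range_filter_intModEq {q e : ℕ} (hq : 0 < q) (he : e ∣ q) (b : ℤ) :
    (#{y ∈ range q | ((y : ℕ) : ℤ) ≡ b [ZMOD (e : ℤ)]} : ℝ) = q / e := by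
  have he0 : 0 < e := Nat.pos_of_dvd_of_pos he hq
  obtain ⟨k, rfl⟩ := he
  have hv : ((b % e).toNat : ℤ) = b % e :=
    Int.toNat_of_nonneg (Int.emod_nonneg _ (by exact_mod_cast he0.ne'))
  have hc : #{y ∈ range (e * k) | ((y : ℕ) : ℤ) ≡ b [ZMOD (e : ℤ)]} = k := by
    have h1 := Nat.count_modEq_card (e * k) he0 (b % e).toNat
    rw [Nat.count_eq_card_filter_range,
      Nat.mul_div_cancel_left _ he0, Nat.mul_mod_right, if_neg (Nat.not_lt_zero _)] at h1
    refine Eq.trans (congrArg card (filter_congr fun y _ => ?_)) h1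
    rw [← Int.natCast_modEq_iff, hv]
    exact ⟨fun h => h.trans (Int.mod_modEq _ _).symm, fun h => h.trans (Int.mod_modEq _ _)⟩
  rw [hc]; push_cast; field_simp

theorem intModEq_iff_of_dvd_mul {M q d : ℕ} (h : M.Coprime q) (hd : d ∣ M * q) (z : ℕ) (b : ℤ) :
    (z : ℤ) ≡ b [ZMOD d] ↔ ((z % M : ℕ) : ℤ) ≡ b [ZMOD (d.gcd M : ℕ)] ∧
      ((z % q : ℕ) : ℤ) ≡ b [ZMOD (d.gcd q : ℕ)] := by
  have hdd : d = d.gcd M * d.gcd q := by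
    rw [← Nat.Coprime.gcd_mul d h, Nat.gcd_eq_left hd]
  have hmod {n e : ℕ} (he : e ∣ n) : ((z % n : ℕ) : ℤ) ≡ z [ZMOD (e : ℤ)] :=
    Int.natCast_modEq_iff.mpr ((Nat.mod_modEq z n).of_dvd he)
  have hco : (d.gcd M).Coprime (d.gcd q) :=
    Nat.Coprime.of_dvd (Nat.gcd_dvd_right _ _) (Nat.gcd_dvd_right _ _) h
  conv_lhs => rw [hdd]
  push_cast
  rw [← Int.modEq_and_modEq_iff_modEq_mul (by simpa using hco)]
  exact and_congr
    ⟨fun k => (hmod (Nat.gcd_dvd_right _ _)).trans k,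
      fun k => (hmod (Nat.gcd_dvd_right _ _)).symm.trans k⟩
    ⟨fun k => (hmod (Nat.gcd_dvd_right _ _)).trans k,
      fun k => (hmod (Nat.gcd_dvd_right _ _)).symm.trans k⟩

/-- The mass allowed to a residue class modulo `d`: at most `1 / d`, up to a factor `4 / 3` for
every prime factor of `d` that is at least `y`. -/
noncomputable def spreadBound (y d : ℕ) : ℝ :=
  (d : ℝ)⁻¹ * ∏ p ∈ d.primeFactors, if y ≤ p then 4 / 3 else 1

/-- The total allowance of the intersections of classes to pairs of divisors of `M`. -/
noncomputable def overlapSum (y M : ℕ) : ℝ :=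
  ∑ d ∈ M.divisors, ∑ e ∈ M.divisors, spreadBound y (d.lcm e)

/-- A probability weight on the residues modulo `M` obeying `spreadBound`, for which the classes
`a m` modulo `m`, with `m ∈ S` dividing `M`, have union of mass at most `u`. -/
structure IsSpread (S : Finset ℕ) (a : ℕ → ℤ) (y M : ℕ) (u : ℝ) (w : ℕ → ℝ) : Prop where
  nonneg : ∀ x, 0 ≤ w x
  sum_eq : ∑ x ∈ range M, w x = 1
  class_le : ∀ d, d ∣ M → ∀ b : ℤ,
    ∑ x ∈ range M with ((x : ℕ) : ℤ) ≡ b [ZMOD (d : ℤ)], w x ≤ spreadBound y d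
  covered_le : ∑ x ∈ range M with ∃ m ∈ S, m ∣ M ∧ ((x : ℕ) : ℤ) ≡ a m [ZMOD (m : ℤ)], w x ≤ u

theorem spreadBound_nonneg (y d : ℕ) : 0 ≤ spreadBound y d :=
  mul_nonneg (by positivity) (prod_nonneg fun p _ => by split_ifs <;> norm_num)

theorem overlapSum_nonneg (y M : ℕ) : 0 ≤ overlapSum y M :=
  sum_nonneg fun _ _ => sum_nonneg fun _ _ => spreadBound_nonneg _ _

theorem spreadBound_one (y : ℕ) : spreadBound y 1 = 1 := by simp [spreadBound]

theorem spreadBound_mul {d e : ℕ} (y : ℕ) (h : d.Coprime e) :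
    spreadBound y (d * e) = spreadBound y d * spreadBound y e := by
  unfold spreadBound
  rw [h.primeFactors_mul, prod_union h.disjoint_primeFactors]
  push_cast
  rw [mul_inv]; ring

theorem spreadBound_prime_pow {y p k : ℕ} (hp : p.Prime) (hk : k ≠ 0) :
    spreadBound y (p ^ k) = (if y ≤ p then 4 / 3 else 1) * ((p : ℝ) ^ k)⁻¹ := by
  unfold spreadBound
  rw [Nat.primeFactors_prime_pow hk hp, prod_singleton]
  push_cast; ring

theorem sum_inv_divisors_prime_pow_erase_one_le {p : ℕ} (hp : p.Prime) (k : ℕ) :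
    ∑ e ∈ (p ^ k).divisors.erase 1, (e : ℝ)⁻¹ ≤ ((p : ℝ) - 1)⁻¹ := by
  have hp1 : (1 : ℝ) < p := by exact_mod_cast hp.one_lt
  have h1 : ∑ e ∈ (p ^ k).divisors, (e : ℝ)⁻¹ ≤ (1 - (p : ℝ)⁻¹)⁻¹ := by
    rw [Nat.sum_divisors_prime_pow hp, ← tsum_geometric_of_lt_one (by positivity)
      (inv_lt_one_of_one_lt₀ hp1)]
    push_cast
    simp only [← inv_pow]
    exact (summable_geometric_of_lt_one (by positivity)
      (inv_lt_one_of_one_lt₀ hp1)).sum_le_tsum _ fun _ _ => by positivity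
  have h2 := sum_erase_add (p ^ k).divisors (fun e : ℕ => (e : ℝ)⁻¹)
    (Nat.one_mem_divisors.mpr (pow_pos hp.pos k).ne')
  have h3 : (1 - (p : ℝ)⁻¹)⁻¹ = ((p : ℝ) - 1)⁻¹ + 1 := by
    have : (p : ℝ) - 1 ≠ 0 := by linarith
    field_simp
    ring
  simp only [Nat.cast_one, inv_one] at h2
  linarith

namespace IsSpread

variable {S : Finset ℕ} {a : ℕ → ℤ} {y M : ℕ} {u : ℝ} {w : ℕ → ℝ}

theorem class_inter_le (hw : IsSpread S a y M u w) {d e : ℕ} (hd : d ∣ M) (he : e ∣ M)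
    (b c : ℤ) :
    ∑ x ∈ range M with ((x : ℕ) : ℤ) ≡ b [ZMOD (d : ℤ)] ∧ ((x : ℕ) : ℤ) ≡ c [ZMOD (e : ℤ)], w x ≤
      spreadBound y (d.lcm e) := by
  rcases (filter (fun x : ℕ => (x : ℤ) ≡ b [ZMOD (d : ℤ)] ∧ (x : ℤ) ≡ c [ZMOD (e : ℤ)])
    (range M)).eq_empty_or_nonempty with h | ⟨z, hz⟩
  · rw [h, sum_empty]; exact spreadBound_nonneg _ _
  · refine le_trans (sum_le_sum_of_subset_of_nonneg ?_ fun x _ _ => hw.nonneg x)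
      (hw.class_le _ (Nat.lcm_dvd hd he) z)
    intro x hx
    rw [mem_filter] at hx hz ⊢
    refine ⟨hx.1, ?_⟩
    have := Int.modEq_and_modEq_iff_modEq_lcm.mp
      ⟨hx.2.1.trans hz.2.1.symm, hx.2.2.trans hz.2.2.symm⟩
    simpa [Int.lcm] using this

theorem sum_sq_le (hw : IsSpread S a y M u w) (hM : 0 < M) {p k : ℕ} (hp : p.Prime)
    {R : Finset ℕ} (hR : ∀ m ∈ R, m ∣ M * p ^ k ∧ ¬ m ∣ M) (hcop : M.Coprime (p ^ k)) :
    ∑ x ∈ range M, w x * (∑ m ∈ R, if (x : ℤ) ≡ a m [ZMOD (m.gcd M : ℕ)]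
      then ((m.gcd (p ^ k) : ℕ) : ℝ)⁻¹ else 0) ^ 2 ≤ overlapSum y M / ((p : ℝ) - 1) ^ 2 := by
  have hp1 : (1 : ℝ) < p := by exact_mod_cast hp.one_lt
  set q := p ^ k with hq
  have hq0 : 0 < q := pow_pos hp.pos k
  set T := M.divisors ×ˢ q.divisors.erase 1 with hT
  set φ : ℕ → ℕ × ℕ := fun m => (m.gcd M, m.gcd q) with hφ
  have hfac {m : ℕ} (hm : m ∈ R) : m.gcd M * m.gcd q = m := by
    rw [← Nat.Coprime.gcd_mul m hcop, Nat.gcd_eq_left (hR m hm).1]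
  have hinj : Set.InjOn φ R := fun m hm n hn h => by
    have h1 : m.gcd M = n.gcd M := congrArg Prod.fst h
    have h2 : m.gcd q = n.gcd q := congrArg Prod.snd h
    rw [← hfac hm, ← hfac hn, h1, h2]
  have hmaps : ∀ m ∈ R, φ m ∈ T := fun m hm => by
    refine mem_product.mpr ⟨Nat.mem_divisors.mpr ⟨Nat.gcd_dvd_right _ _, hM.ne'⟩,
      mem_erase.mpr ⟨fun h => (hR m hm).2 ?_, Nat.mem_divisors.mpr
        ⟨Nat.gcd_dvd_right _ _, hq0.ne'⟩⟩⟩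
    have h1 := hfac hm
    have h2 : m.gcd q = 1 := h
    rw [h2, mul_one] at h1
    exact h1 ▸ Nat.gcd_dvd_right m M
  have hsum (F : ℕ × ℕ → ℝ) (hF : ∀ t, 0 ≤ F t) : ∑ m ∈ R, F (φ m) ≤ ∑ t ∈ T, F t := by
    rw [← sum_image hinj]
    exact sum_le_sum_of_subset_of_nonneg (image_subset_iff.mpr hmaps) fun t _ _ => hF t
  calc ∑ x ∈ range M, w x * (∑ m ∈ R, if (x : ℤ) ≡ a m [ZMOD (m.gcd M : ℕ)]
        then ((m.gcd q : ℕ) : ℝ)⁻¹ else 0) ^ 2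
      = ∑ m ∈ R, ∑ n ∈ R, ((m.gcd q : ℕ) : ℝ)⁻¹ * ((n.gcd q : ℕ) : ℝ)⁻¹ *
          ∑ x ∈ range M with ((x : ℕ) : ℤ) ≡ a m [ZMOD (m.gcd M : ℕ)] ∧
            ((x : ℕ) : ℤ) ≡ a n [ZMOD (n.gcd M : ℕ)], w x := by
        simp_rw [sq, sum_mul_sum, mul_sum, sum_filter]
        rw [sum_comm]
        refine sum_congr rfl fun m _ => ?_
        rw [sum_comm]
        refine sum_congr rfl fun n _ => sum_congr rfl fun x _ => ?_
        split_ifs <;> simp_all; ring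
    _ ≤ ∑ m ∈ R, ∑ n ∈ R, ((m.gcd q : ℕ) : ℝ)⁻¹ * ((n.gcd q : ℕ) : ℝ)⁻¹ *
          spreadBound y ((m.gcd M).lcm (n.gcd M)) := by
        gcongr
        exact hw.class_inter_le (Nat.gcd_dvd_right _ _) (Nat.gcd_dvd_right _ _) _ _
    _ ≤ ∑ m ∈ R, ∑ t ∈ T, ((m.gcd q : ℕ) : ℝ)⁻¹ * (t.2 : ℝ)⁻¹ *
          spreadBound y ((m.gcd M).lcm t.1) :=
        sum_le_sum fun m _ => hsum (fun t => ((m.gcd q : ℕ) : ℝ)⁻¹ * (t.2 : ℝ)⁻¹ *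
          spreadBound y ((m.gcd M).lcm t.1))
          fun t => mul_nonneg (by positivity) (spreadBound_nonneg _ _)
    _ ≤ ∑ s ∈ T, ∑ t ∈ T, (s.2 : ℝ)⁻¹ * (t.2 : ℝ)⁻¹ * spreadBound y (s.1.lcm t.1) :=
        hsum (fun s => ∑ t ∈ T, (s.2 : ℝ)⁻¹ * (t.2 : ℝ)⁻¹ * spreadBound y (s.1.lcm t.1))
          fun s => sum_nonneg fun t _ => mul_nonneg (by positivity) (spreadBound_nonneg _ _)
    _ = overlapSum y M * (∑ e ∈ q.divisors.erase 1, (e : ℝ)⁻¹) ^ 2 := by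
        rw [hT, sum_product, overlapSum, sum_mul]
        refine sum_congr rfl fun d _ => ?_
        rw [sum_mul]
        simp_rw [sum_product]
        rw [sum_comm]
        refine sum_congr rfl fun e _ => ?_
        rw [sq, sum_mul_sum, mul_sum, sum_comm]
        refine sum_congr rfl fun i _ => ?_
        rw [mul_sum]
        exact sum_congr rfl fun j _ => by ring
    _ ≤ overlapSum y M / ((p : ℝ) - 1) ^ 2 := by
        rw [div_eq_mul_inv, ← inv_pow]
        have h0 := overlapSum_nonneg y M
        have h1 := sum_inv_divisors_prime_pow_erase_one_le hp k
        gcongr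

end IsSpread

namespace IsSpread

variable {S : Finset ℕ} {a : ℕ → ℤ} {y M : ℕ} {u : ℝ} {w : ℕ → ℝ}

/-- One step of the distortion method, adjoining the full power of a new prime `p ≥ y`. -/
theorem exists_mul_prime_pow (hw : IsSpread S a y M u w) (hM : 0 < M) {p : ℕ} (hp : p.Prime)
    (hy : y ≤ p) (hpM : ¬ p ∣ M) (k : ℕ) :
    ∃ w', IsSpread S a y (M * p ^ k) (u + 4 / 3 * (overlapSum y M / ((p : ℝ) - 1) ^ 2)) w' := by
  have hcop : M.Coprime (p ^ k) := ((Nat.Prime.coprime_iff_not_dvd hp).mpr hpM).symm.pow_right k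
  have hsq := fun R hR => hw.sum_sq_le (R := R) hM (k := k) hp hR hcop
  have hspread : ∀ e, e ∣ p ^ k → e ≠ 1 → spreadBound y e = 4 / 3 * (e : ℝ)⁻¹ := by
    intro e he he1
    obtain ⟨j, -, rfl⟩ := (Nat.dvd_prime_pow hp).mp he
    rw [spreadBound_prime_pow hp (by rintro rfl; simp at he1), if_pos hy]
    push_cast; rfl
  set q := p ^ k with hq
  have hq0 : 0 < q := pow_pos hp.pos k
  have hq' : (0 : ℝ) < q := by exact_mod_cast hq0
  set R := {m ∈ S | m ∣ M * q ∧ ¬ m ∣ M} with hR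
  set B : ℕ → Finset ℕ := fun x => {t ∈ range q | ∃ m ∈ R, (x : ℤ) ≡ a m [ZMOD (m.gcd M : ℕ)] ∧
    ((t : ℕ) : ℤ) ≡ a m [ZMOD (m.gcd q : ℕ)]} with hB
  choose g hg0 hg1 hgsum hgB using fun x : ℕ =>
    exists_fibre_density (Y := range q) (B := B x) ⟨0, mem_range.mpr hq0⟩ (filter_subset _ _)
  simp only [card_range] at hgsum hgB
  have hdensity (x : ℕ) : (#(B x) : ℝ) / q ≤ ∑ m ∈ R, if (x : ℤ) ≡ a m [ZMOD (m.gcd M : ℕ)]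
      then ((m.gcd q : ℕ) : ℝ)⁻¹ else 0 := by
    rw [div_le_iff₀ hq', sum_mul]
    have h1 : B x ⊆ R.biUnion fun m => {t ∈ range q | (x : ℤ) ≡ a m [ZMOD (m.gcd M : ℕ)] ∧
        ((t : ℕ) : ℤ) ≡ a m [ZMOD (m.gcd q : ℕ)]} := by
      intro t ht
      obtain ⟨ht, m, hm, h⟩ := mem_filter.mp ht
      exact mem_biUnion.mpr ⟨m, hm, mem_filter.mpr ⟨ht, h⟩⟩
    have h2 := (card_le_card h1).trans card_biUnion_le
    refine (Nat.cast_le (α := ℝ).mpr h2).trans ?_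
    push_cast
    refine sum_le_sum fun m _ => ?_
    split_ifs with h
    · simp only [h, true_and]
      rw [card_range_filter_intModEq hq0 (Nat.gcd_dvd_right _ _)]
      exact le_of_eq (by ring)
    · simp [h]
  have hfibre {e : ℕ} (he : e ∣ q) (x : ℕ) (b : ℤ) :
      ∑ t ∈ range q with ((t : ℕ) : ℤ) ≡ b [ZMOD (e : ℤ)], g x t / q ≤ spreadBound y e := by
    rcases eq_or_ne e 1 with rfl | he1
    · rw [spreadBound_one, filter_true_of_mem fun t _ => by simpa using Int.modEq_one,
        ← sum_div, hgsum, div_self hq'.ne']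
    · rw [hspread e he he1]
      refine (sum_le_sum fun t _ => div_le_div_of_nonneg_right (hg1 x t) hq'.le).trans ?_
      rw [sum_const, nsmul_eq_mul, card_range_filter_intModEq hq0 he]
      exact le_of_eq (by field_simp)
  have hw0 (x t : ℕ) : 0 ≤ w x * (g x t / q) :=
    mul_nonneg (hw.nonneg x) (div_nonneg (hg0 x t) hq'.le)
  have hmarginal (x : ℕ) : ∑ t ∈ range q, w x * (g x t / q) = w x := by
    rw [← mul_sum, ← sum_div, hgsum, div_self hq'.ne', mul_one]
  refine ⟨fun z => w (z % M) * (g (z % M) (z % q) / q), fun z => hw0 _ _, ?_, ?_, ?_⟩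
  · rw [sum_range_mul_of_coprime hcop hM hq0 fun x t => w x * (g x t / q)]
    simp only [hmarginal, hw.sum_eq]
  · intro d hd b
    have hdd : d = d.gcd M * d.gcd q := by
      rw [← Nat.Coprime.gcd_mul d hcop, Nat.gcd_eq_left hd]
    have hdco : (d.gcd M).Coprime (d.gcd q) :=
      Nat.Coprime.of_dvd (Nat.gcd_dvd_right _ _) (Nat.gcd_dvd_right _ _) hcop
    rw [sum_filter]
    simp only [intModEq_iff_of_dvd_mul hcop hd]
    rw [sum_range_mul_of_coprime hcop hM hq0 fun x t =>
      if (x : ℤ) ≡ b [ZMOD (d.gcd M : ℕ)] ∧ (t : ℤ) ≡ b [ZMOD (d.gcd q : ℕ)]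
      then w x * (g x t / q) else 0]
    calc _ = ∑ x ∈ range M with ((x : ℕ) : ℤ) ≡ b [ZMOD (d.gcd M : ℕ)], w x *
            ∑ t ∈ range q with ((t : ℕ) : ℤ) ≡ b [ZMOD (d.gcd q : ℕ)], g x t / q := by
          rw [sum_filter]
          refine sum_congr rfl fun x _ => ?_
          split_ifs with h
          · simp only [h, true_and, mul_sum, sum_filter, mul_ite, mul_zero]
          · simp [h]
      _ ≤ ∑ x ∈ range M with ((x : ℕ) : ℤ) ≡ b [ZMOD (d.gcd M : ℕ)],
            w x * spreadBound y (d.gcd q) :=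
          sum_le_sum fun x _ => mul_le_mul_of_nonneg_left
            (hfibre (Nat.gcd_dvd_right _ _) x b) (hw.nonneg x)
      _ ≤ spreadBound y (d.gcd M) * spreadBound y (d.gcd q) := by
          rw [← sum_mul]
          exact mul_le_mul_of_nonneg_right (hw.class_le _ (Nat.gcd_dvd_right _ _) b)
            (spreadBound_nonneg _ _)
      _ = spreadBound y d := by rw [← spreadBound_mul y hdco, ← hdd]
  · calc _ ≤ ∑ z ∈ range (M * q),
          ((if ∃ m ∈ S, m ∣ M ∧ ((z % M : ℕ) : ℤ) ≡ a m [ZMOD (m : ℤ)]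
            then w (z % M) * (g (z % M) (z % q) / q) else 0) +
          (if z % q ∈ B (z % M) then w (z % M) * (g (z % M) (z % q) / q) else 0)) := by
          rw [sum_filter]
          refine sum_le_sum fun z _ => ?_
          have h0 := hw0 (z % M) (z % q)
          split_ifs with h1 h2 h3 h3 h2 h3 h3 <;> try linarith
          exfalso
          obtain ⟨m, hm, hmd, hz⟩ := h1
          rw [intModEq_iff_of_dvd_mul hcop hmd] at hz
          by_cases hmM : m ∣ M
          · rw [Nat.gcd_eq_left hmM] at hz
            exact h2 ⟨m, hm, hmM, hz.1⟩
          · exact h3 (mem_filter.mpr ⟨mem_range.mpr (Nat.mod_lt _ hq0), m,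
              mem_filter.mpr ⟨hm, hmd, hmM⟩, hz⟩)
      _ = ∑ x ∈ range M, ∑ t ∈ range q,
          ((if ∃ m ∈ S, m ∣ M ∧ (x : ℤ) ≡ a m [ZMOD (m : ℤ)] then w x * (g x t / q) else 0) +
          (if t ∈ B x then w x * (g x t / q) else 0)) :=
          sum_range_mul_of_coprime hcop hM hq0 fun x t =>
            ((if ∃ m ∈ S, m ∣ M ∧ (x : ℤ) ≡ a m [ZMOD (m : ℤ)] then w x * (g x t / q) else 0) +
            (if t ∈ B x then w x * (g x t / q) else 0))
      _ = ∑ x ∈ range M with ∃ m ∈ S, m ∣ M ∧ ((x : ℕ) : ℤ) ≡ a m [ZMOD (m : ℤ)], w x +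
          ∑ x ∈ range M, w x * ((∑ t ∈ B x, g x t) / q) := by
          rw [sum_filter, ← sum_add_distrib]
          refine sum_congr rfl fun x _ => ?_
          rw [sum_add_distrib]
          congr 1
          · split_ifs
            · exact hmarginal x
            · exact sum_const_zero
          · rw [← sum_filter, filter_mem_eq_inter, inter_eq_right.mpr (filter_subset _ _),
              sum_div, mul_sum]
      _ ≤ u + ∑ x ∈ range M, w x * (4 / 3 * (∑ m ∈ R, if (x : ℤ) ≡ a m [ZMOD (m.gcd M : ℕ)]
            then ((m.gcd q : ℕ) : ℝ)⁻¹ else 0) ^ 2) := by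
          refine add_le_add hw.covered_le (sum_le_sum fun x _ =>
            mul_le_mul_of_nonneg_left ?_ (hw.nonneg x))
          rw [div_le_iff₀ hq']
          refine (hgB x).trans ?_
          gcongr
          exact hdensity x
      _ ≤ _ := by
          gcongr
          refine le_trans (le_of_eq ?_) (mul_le_mul_of_nonneg_left
            (hsq R fun m hm => (mem_filter.mp hm).2) (by norm_num : (0 : ℝ) ≤ 4 / 3))
          rw [mul_sum]
          exact sum_congr rfl fun x _ => by ring

end IsSpread

theorem lcm_mul_mul_of_coprime {M q d d' e e' : ℕ} (h : M.Coprime q) (hd : d ∣ M) (hd' : d' ∣ M)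
    (he : e ∣ q) (he' : e' ∣ q) : (d * e).lcm (d' * e') = d.lcm d' * e.lcm e' := by
  apply Nat.dvd_antisymm
  · exact Nat.lcm_dvd (mul_dvd_mul (Nat.dvd_lcm_left _ _) (Nat.dvd_lcm_left _ _))
      (mul_dvd_mul (Nat.dvd_lcm_right _ _) (Nat.dvd_lcm_right _ _))
  · refine Nat.Coprime.mul_dvd_of_dvd_of_dvd
      (Nat.Coprime.of_dvd (Nat.lcm_dvd hd hd') (Nat.lcm_dvd he he') h)
      (Nat.lcm_dvd ?_ ?_) (Nat.lcm_dvd ?_ ?_)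
    · exact (dvd_mul_right _ _).trans (Nat.dvd_lcm_left _ _)
    · exact (dvd_mul_right _ _).trans (Nat.dvd_lcm_right _ _)
    · exact (dvd_mul_left _ _).trans (Nat.dvd_lcm_left _ _)
    · exact (dvd_mul_left _ _).trans (Nat.dvd_lcm_right _ _)

theorem overlapSum_mul {M q : ℕ} (y : ℕ) (h : M.Coprime q) :
    overlapSum y (M * q) = overlapSum y M * overlapSum y q := by
  have hsum (F : ℕ → ℝ) : ∑ d ∈ (M * q).divisors, F d =
      ∑ d ∈ M.divisors, ∑ e ∈ q.divisors, F (d * e) := by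
    rw [Nat.divisors_mul, mul_def, sum_image h.mul_injOn_divisors, sum_product]
  unfold overlapSum
  simp_rw [hsum, sum_mul_sum]
  refine sum_congr rfl fun d hd => sum_congr rfl fun e he => ?_
  refine sum_congr rfl fun d' hd' => sum_congr rfl fun e' he' => ?_
  have hd := Nat.dvd_of_mem_divisors hd
  have hd' := Nat.dvd_of_mem_divisors hd'
  have he := Nat.dvd_of_mem_divisors he
  have he' := Nat.dvd_of_mem_divisors he'
  rw [lcm_mul_mul_of_coprime h hd hd' he he', spreadBound_mul y
    (Nat.Coprime.of_dvd (Nat.lcm_dvd hd hd') (Nat.lcm_dvd he he') h)]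

theorem sum_range_sum_range_max (f : ℕ → ℝ) (n : ℕ) :
    ∑ i ∈ range (n + 1), ∑ j ∈ range (n + 1), f (max i j) =
      ∑ i ∈ range n, ∑ j ∈ range n, f (max i j) + (2 * n + 1) * f n := by
  have h1 : ∀ i ∈ range n, f (max i n) = f n := fun i hi => by
    rw [max_eq_right (mem_range.mp hi).le]
  have h2 : ∀ i ∈ range n, f (max n i) = f n := fun i hi => by
    rw [max_eq_left (mem_range.mp hi).le]
  simp_rw [sum_range_succ, sum_add_distrib]
  rw [sum_congr rfl h1, sum_congr rfl h2]
  simp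
  ring

theorem overlapSum_prime_pow_le {p : ℕ} (y : ℕ) (hp : p.Prime) (k : ℕ) :
    overlapSum y (p ^ k) ≤
      1 + (if y ≤ p then 4 / 3 else 1) * ((3 * p - 1) / ((p : ℝ) - 1) ^ 2) := by
  have hp1 : (1 : ℝ) < p := by exact_mod_cast hp.one_lt
  have hp2 : (p : ℝ) - 1 ≠ 0 := by linarith
  set c : ℝ := if y ≤ p then 4 / 3 else 1 with hc
  have hc0 : 0 ≤ c := by rw [hc]; split_ifs <;> norm_num
  have hmax (i j : ℕ) : (p ^ i).lcm (p ^ j) = p ^ max i j := by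
    rcases le_total i j with h | h
    · rw [max_eq_right h, Nat.lcm_eq_right (pow_dvd_pow p h)]
    · rw [max_eq_left h, Nat.lcm_eq_left (pow_dvd_pow p h)]
  have hclosed : overlapSum y (p ^ k) = 1 + c * ((3 * p - 1) / ((p : ℝ) - 1) ^ 2 -
      ((p : ℝ) ^ k)⁻¹ * (2 * k / ((p : ℝ) - 1) + (3 * p - 1) / ((p : ℝ) - 1) ^ 2)) := by
    unfold overlapSum
    simp only [Nat.sum_divisors_prime_pow hp, hmax]
    induction k with
    | zero => simp [spreadBound_one]
    | succ k ih =>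
      rw [sum_range_sum_range_max fun i => spreadBound y (p ^ i), ih,
        spreadBound_prime_pow (k := k + 1) hp (by omega), ← hc, pow_succ]
      push_cast
      field_simp
      ring
  rw [hclosed]
  gcongr
  have : 0 ≤ ((p : ℝ) ^ k)⁻¹ * (2 * k / ((p : ℝ) - 1) + (3 * p - 1) / ((p : ℝ) - 1) ^ 2) := by
    have h1 : (0 : ℝ) < p - 1 := by linarith
    have h2 : (0 : ℝ) < 3 * p - 1 := by linarith
    positivity
  linarith

/-- The largest divisor of `Q` all of whose prime factors are less than `n`. -/
def smoothPart (Q n : ℕ) : ℕ := ∏ p ∈ n.primesBelow, p ^ Q.factorization p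

/-- The factor contributed by the prime `p` to the bound on `overlapSum y`. -/
noncomputable def overlapFactor (y p : ℕ) : ℝ :=
  1 + (if y ≤ p then 4 / 3 else 1) * ((3 * p - 1) / ((p : ℝ) - 1) ^ 2)

theorem smoothPart_pos (Q n : ℕ) : 0 < smoothPart Q n :=
  prod_pos fun _ hp => pow_pos (Nat.prime_of_mem_primesBelow hp).pos _

theorem primesBelow_succ_of_prime {n : ℕ} (hn : n.Prime) :
    (n + 1).primesBelow = insert n n.primesBelow := by
  rw [Nat.primesBelow_succ, if_pos hn]

theorem primesBelow_succ_of_not_prime {n : ℕ} (hn : ¬ n.Prime) :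
    (n + 1).primesBelow = n.primesBelow := by
  rw [Nat.primesBelow_succ, if_neg hn]

theorem smoothPart_succ_of_prime (Q : ℕ) {n : ℕ} (hn : n.Prime) :
    smoothPart Q (n + 1) = smoothPart Q n * n ^ Q.factorization n := by
  rw [smoothPart, primesBelow_succ_of_prime hn, prod_insert (Nat.notMem_primesBelow n), mul_comm,
    smoothPart]

theorem smoothPart_succ_of_not_prime (Q : ℕ) {n : ℕ} (hn : ¬ n.Prime) :
    smoothPart Q (n + 1) = smoothPart Q n := by
  rw [smoothPart, primesBelow_succ_of_not_prime hn, smoothPart]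

theorem lt_of_prime_of_dvd_smoothPart {Q n p : ℕ} (hp : p.Prime) (h : p ∣ smoothPart Q n) :
    p < n := by
  obtain ⟨r, hr, hpr⟩ := (hp.prime.dvd_finsetProd_iff _).mp h
  rw [(Nat.prime_dvd_prime_iff_eq hp (Nat.prime_of_mem_primesBelow hr)).mp
    (hp.dvd_of_dvd_pow hpr)]
  exact Nat.lt_of_mem_primesBelow hr

theorem smoothPart_eq_self {Q n : ℕ} (hQ : Q ≠ 0) (hn : Q < n) : smoothPart Q n = Q := by
  conv_rhs => rw [← Nat.prod_factorization_pow_eq_self hQ]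
  rw [Nat.prod_factorization_eq_prod_primeFactors, smoothPart]
  refine (prod_subset (fun p hp => ?_) fun p hp hp' => ?_).symm
  · exact Nat.mem_primesBelow.mpr ⟨(Nat.le_of_mem_primeFactors hp).trans_lt hn,
      Nat.prime_of_mem_primeFactors hp⟩
  · rw [Finsupp.notMem_support_iff.mp (by rwa [Nat.support_factorization]), pow_zero]

theorem one_le_overlapFactor {y p : ℕ} (hp : p.Prime) : 1 ≤ overlapFactor y p := by
  have hp1 : (1 : ℝ) < p := by exact_mod_cast hp.one_lt
  have h2 : (0 : ℝ) ≤ 3 * p - 1 := by linarith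
  unfold overlapFactor
  split_ifs <;> simp only [le_add_iff_nonneg_right] <;> positivity

theorem overlapSum_smoothPart_le (Q y n : ℕ) :
    overlapSum y (smoothPart Q n) ≤ ∏ p ∈ n.primesBelow, overlapFactor y p := by
  induction n with
  | zero => simp [smoothPart, overlapSum, spreadBound_one]
  | succ n ih =>
    by_cases hn : n.Prime
    · have hcop : (smoothPart Q n).Coprime n := ((Nat.Prime.coprime_iff_not_dvd hn).mpr
        fun h => (lt_of_prime_of_dvd_smoothPart hn h).false).symm
      rw [smoothPart_succ_of_prime Q hn, primesBelow_succ_of_prime hn,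
        prod_insert (Nat.notMem_primesBelow n), mul_comm (overlapFactor y n),
        overlapSum_mul y (hcop.pow_right _)]
      exact mul_le_mul ih (overlapSum_prime_pow_le y hn _) (overlapSum_nonneg _ _)
        ((overlapSum_nonneg _ _).trans ih)
    · rwa [smoothPart_succ_of_not_prime Q hn, primesBelow_succ_of_not_prime hn]

/-- The total mass lost by the distortion method to the primes in `[y, n)`. -/
noncomputable def distortionLoss (y n : ℕ) : ℝ :=
  ∑ p ∈ n.primesBelow with y ≤ p, (∏ r ∈ p.primesBelow, overlapFactor y r) / ((p : ℝ) - 1) ^ 2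

theorem distortionLoss_self (y : ℕ) : distortionLoss y y = 0 := by
  rw [distortionLoss, filter_false_of_mem fun p hp => (Nat.lt_of_mem_primesBelow hp).not_ge,
    sum_empty]

theorem isSpread_uniform (S : Finset ℕ) (a : ℕ → ℤ) (Q y : ℕ) :
    IsSpread S a y (smoothPart Q y) (∑ m ∈ S with m ∣ smoothPart Q y, (m : ℝ)⁻¹)
      fun _ => (smoothPart Q y : ℝ)⁻¹ := by
  have hM := smoothPart_pos Q y
  have hlt := fun p hp => lt_of_prime_of_dvd_smoothPart (Q := Q) (n := y) (p := p) hp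
  set M := smoothPart Q y
  have hM0 : (M : ℝ) ≠ 0 := by exact_mod_cast hM.ne'
  have hclass {d : ℕ} (hd : d ∣ M) (b : ℤ) :
      ∑ x ∈ range M with ((x : ℕ) : ℤ) ≡ b [ZMOD (d : ℤ)], (M : ℝ)⁻¹ = (d : ℝ)⁻¹ := by
    rw [sum_const, nsmul_eq_mul, card_range_filter_intModEq hM hd]
    field_simp
  refine ⟨fun _ => by positivity, ?_, fun d hd b => ?_, ?_⟩
  · rw [sum_const, card_range, nsmul_eq_mul, mul_inv_cancel₀ hM0]
  · rw [hclass hd, spreadBound, prod_eq_one, mul_one]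
    intro p hp
    rw [if_neg (hlt p (Nat.prime_of_mem_primeFactors hp)
      ((Nat.dvd_of_mem_primeFactors hp).trans hd)).not_ge]
  · rw [← sum_congr rfl fun m hm => hclass (mem_filter.mp hm).2 (a m)]
    simp only [sum_const, nsmul_eq_mul, ← sum_mul]
    refine mul_le_mul_of_nonneg_right ?_ (by positivity)
    rw [← Nat.cast_sum, Nat.cast_le]
    refine le_trans (card_le_card fun x hx => ?_) card_biUnion_le
    obtain ⟨hx, m, hm, hd, h⟩ := mem_filter.mp hx
    exact mem_biUnion.mpr ⟨m, mem_filter.mpr ⟨hm, hd⟩, mem_filter.mpr ⟨hx, h⟩⟩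

theorem exists_isSpread_smoothPart (S : Finset ℕ) (a : ℕ → ℤ) (Q y : ℕ) {n : ℕ} (hn : y ≤ n) :
    ∃ w, IsSpread S a y (smoothPart Q n)
      (∑ m ∈ S with m ∣ smoothPart Q y, (m : ℝ)⁻¹ + 4 / 3 * distortionLoss y n) w := by
  induction n, hn using Nat.le_induction with
  | base =>
    rw [distortionLoss_self, mul_zero, add_zero]
    exact ⟨_, isSpread_uniform S a Q y⟩
  | succ n hn ih =>
    obtain ⟨w, hw⟩ := ih
    by_cases hp : n.Prime
    · obtain ⟨w', hw'⟩ := hw.exists_mul_prime_pow (smoothPart_pos Q n) hp hn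
        (fun h => (lt_of_prime_of_dvd_smoothPart hp h).false) (Q.factorization n)
      rw [← smoothPart_succ_of_prime Q hp] at hw'
      refine ⟨w', { hw' with covered_le := hw'.covered_le.trans ?_ }⟩
      rw [distortionLoss, distortionLoss, primesBelow_succ_of_prime hp, filter_insert, if_pos hn,
        sum_insert (fun h => Nat.notMem_primesBelow n (mem_filter.mp h).1)]
      have := div_le_div_of_nonneg_right (overlapSum_smoothPart_le Q y n)
        (sq_nonneg ((n : ℝ) - 1))
      linarith
    · rw [smoothPart_succ_of_not_prime Q hp, distortionLoss, primesBelow_succ_of_not_prime hp]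
      exact ⟨w, hw⟩

theorem one_le_of_covering {S : Finset ℕ} (hS : ∀ m ∈ S, m ≠ 0) {a : ℕ → ℤ}
    (hcov : ∀ n : ℤ, ∃ m ∈ S, n ≡ a m [ZMOD (m : ℤ)]) (y : ℕ) :
    ∃ Q n₀, ∀ n, n₀ ≤ n →
      1 ≤ ∑ m ∈ S with m ∣ smoothPart Q y, (m : ℝ)⁻¹ + 4 / 3 * distortionLoss y n := by
  have hQ : ∏ m ∈ S, m ≠ 0 := prod_ne_zero_iff.mpr hS
  refine ⟨∏ m ∈ S, m, max y (∏ m ∈ S, m + 1), fun n hn => ?_⟩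
  obtain ⟨w, hw⟩ := exists_isSpread_smoothPart S a (∏ m ∈ S, m) y ((le_max_left _ _).trans hn)
  refine le_trans (le_of_eq ?_) hw.covered_le
  rw [← hw.sum_eq, filter_true_of_mem]
  intro x _
  obtain ⟨m, hm, h⟩ := hcov x
  refine ⟨m, hm, ?_, h⟩
  rw [smoothPart_eq_self hQ (Nat.lt_of_succ_le ((le_max_right _ _).trans hn))]
  exact dvd_prod_of_mem _ hm

/-- The primes in the dyadic interval `[2 ^ k, 2 ^ (k + 1))`. -/
def dyadicPrimes (k : ℕ) : Finset ℕ := {p ∈ (2 ^ (k + 1)).primesBelow | 2 ^ k ≤ p}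

theorem prime_of_mem_dyadicPrimes {k p : ℕ} (hp : p ∈ dyadicPrimes k) : p.Prime :=
  Nat.prime_of_mem_primesBelow (mem_filter.mp hp).1

theorem two_pow_lt_of_mem_dyadicPrimes {k p : ℕ} (hk : 2 ≤ k) (hp : p ∈ dyadicPrimes k) :
    2 ^ k < p :=
  lt_of_le_of_ne (mem_filter.mp hp).2 fun h =>
    Nat.Prime.not_prime_pow hk (h ▸ prime_of_mem_dyadicPrimes hp)

theorem mul_card_dyadicPrimes_le {k : ℕ} (hk : 2 ≤ k) : k * #(dyadicPrimes k) ≤ 2 ^ (k + 1) := by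
  have hdvd : ∏ p ∈ dyadicPrimes k, p ∣ Nat.centralBinom (2 ^ k) := by
    refine prod_primes_dvd _ (fun p hp => (prime_of_mem_dyadicPrimes hp).prime) fun p hp => ?_
    have hlt := two_pow_lt_of_mem_dyadicPrimes hk hp
    rw [Nat.centralBinom, two_mul]
    refine (prime_of_mem_dyadicPrimes hp).dvd_choose_add hlt hlt ?_
    rw [← two_mul, ← pow_succ']
    exact (Nat.lt_of_mem_primesBelow (mem_filter.mp hp).1).le
  have h1 : (2 ^ k) ^ #(dyadicPrimes k) ≤ ∏ p ∈ dyadicPrimes k, p :=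
    pow_card_le_prod _ _ _ fun p hp => (mem_filter.mp hp).2
  have h2 := Nat.le_of_dvd (Nat.centralBinom_pos _) hdvd
  have h3 := Nat.centralBinom_lt_four_pow (n := 2 ^ k) (by positivity)
  refine (Nat.pow_le_pow_iff_right (a := 2) (by norm_num)).mp ?_
  calc 2 ^ (k * #(dyadicPrimes k)) = (2 ^ k) ^ #(dyadicPrimes k) := pow_mul _ _ _
    _ ≤ 4 ^ (2 ^ k) := (h1.trans h2).trans h3.le
    _ = 2 ^ (2 ^ (k + 1)) := by rw [pow_succ, mul_comm (2 ^ k), pow_mul]; norm_num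

theorem card_dyadicPrimes_le {k : ℕ} (hk : 14 ≤ k) : (#(dyadicPrimes k) : ℝ) ≤ 2 ^ k / 7 := by
  have h1 := mul_card_dyadicPrimes_le (k := k) (by omega)
  have h2 : 7 * #(dyadicPrimes k) ≤ 2 ^ k := by
    have := Nat.mul_le_mul_right #(dyadicPrimes k) hk
    rw [pow_succ] at h1
    omega
  rw [le_div_iff₀ (by norm_num), mul_comm]
  exact_mod_cast h2

theorem filter_primesBelow_not_two_pow_le (k : ℕ) :
    (2 ^ (k + 1)).primesBelow.filter (fun p => ¬ 2 ^ k ≤ p) = (2 ^ k).primesBelow := by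
  ext p
  have : 2 ^ k ≤ 2 ^ (k + 1) := Nat.pow_le_pow_right (by norm_num) k.le_succ
  simp only [mem_filter, Nat.mem_primesBelow, not_le]
  constructor
  · exact fun h => ⟨h.2, h.1.2⟩
  · exact fun h => ⟨⟨h.1.trans_le this, h.2⟩, h.1⟩

theorem exp_four_div_seven_le : Real.exp (4001 / 7000) ≤ 16 / 9 := by
  have := Real.exp_bound' (x := 4001 / 7000) (by norm_num) (by norm_num) (n := 6) (by norm_num)
  refine this.trans ?_
  norm_num [sum_range_succ, Nat.factorial]

theorem overlapFactor_le {p k : ℕ} (y : ℕ) (hk : 14 ≤ k) (hp : 2 ^ k < p) :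
    overlapFactor y p ≤ Real.exp (4001 / 1000 / 2 ^ k) := by
  have h1 : (16384 : ℝ) ≤ 2 ^ k := by
    calc (16384 : ℝ) = 2 ^ 14 := by norm_num
      _ ≤ 2 ^ k := pow_le_pow_right₀ (by norm_num) hk
  have h2 : (2 : ℝ) ^ k ≤ p - 1 := by
    have : (2 : ℝ) ^ k + 1 ≤ p := by exact_mod_cast hp
    linarith
  obtain ⟨t, ht⟩ : ∃ t : ℝ, (p : ℝ) - 1 = t := ⟨_, rfl⟩
  rw [ht] at h2
  have h3 : (p : ℝ) = t + 1 := by linarith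
  have ht0 : 0 < t := by linarith
  have h4 : (3 * p - 1) / ((p : ℝ) - 1) ^ 2 ≤ 3 / 4 * (4001 / 1000 / t) := by
    have h4' : 3 / 4 * (4001 / 1000 / t) = 12003 / 4000 / t := by ring
    rw [h3, add_sub_cancel_right, h4', div_le_div_iff₀ (by positivity) (by positivity)]
    nlinarith
  have h5 : (0 : ℝ) ≤ 4001 / 1000 / t := by positivity
  have h6 : overlapFactor y p ≤ 1 + 4001 / 1000 / t := by
    unfold overlapFactor
    split_ifs <;> linarith
  have h7 : 4001 / 1000 / t ≤ 4001 / 1000 / 2 ^ k := by gcongr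
  have h8 := Real.add_one_le_exp (4001 / 1000 / 2 ^ k : ℝ)
  linarith

theorem one_le_prod_overlapFactor (y n : ℕ) : 1 ≤ ∏ p ∈ n.primesBelow, overlapFactor y p :=
  prod_induction _ (1 ≤ ·) (fun _ _ => one_le_mul_of_one_le_of_one_le) le_rfl
    fun _ hp => one_le_overlapFactor (Nat.prime_of_mem_primesBelow hp)

theorem prod_overlapFactor_mono (y : ℕ) :
    Monotone fun n : ℕ => ∏ p ∈ n.primesBelow, overlapFactor y p := by
  intro m n h
  dsimp only
  rw [← prod_sdiff (Nat.primesBelow_mono h)]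
  refine le_mul_of_one_le_left (zero_le_one.trans (one_le_prod_overlapFactor y m)) ?_
  exact prod_induction _ (1 ≤ ·) (fun _ _ => one_le_mul_of_one_le_of_one_le) le_rfl
    fun _ hp => one_le_overlapFactor (Nat.prime_of_mem_primesBelow (mem_sdiff.mp hp).1)

theorem prod_overlapFactor_le (y : ℕ) {k : ℕ} (hk : 14 ≤ k) :
    ∏ p ∈ (2 ^ (k + 1)).primesBelow, overlapFactor y p ≤
      16 / 9 * ∏ p ∈ (2 ^ k).primesBelow, overlapFactor y p := by
  rw [← prod_filter_mul_prod_filter_not _ (fun p => 2 ^ k ≤ p),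
    filter_primesBelow_not_two_pow_le]
  refine mul_le_mul_of_nonneg_right ?_ (zero_le_one.trans (one_le_prod_overlapFactor y _))
  calc ∏ p ∈ dyadicPrimes k, overlapFactor y p
      ≤ ∏ p ∈ dyadicPrimes k, Real.exp (4001 / 1000 / 2 ^ k) :=
        prod_le_prod
          (fun p hp => zero_le_one.trans (one_le_overlapFactor (prime_of_mem_dyadicPrimes hp)))
          fun p hp => overlapFactor_le y hk (two_pow_lt_of_mem_dyadicPrimes (by omega) hp)
    _ = Real.exp (#(dyadicPrimes k) * (4001 / 1000 / 2 ^ k)) := by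
        rw [prod_const, Real.exp_nat_mul]
    _ ≤ Real.exp (4001 / 7000) := by
        refine Real.exp_le_exp.mpr ((mul_le_mul_of_nonneg_right (card_dyadicPrimes_le hk)
          (by positivity)).trans (le_of_eq ?_))
        field_simp
        norm_num
    _ ≤ 16 / 9 := exp_four_div_seven_le

theorem distortionLoss_two_pow_le {k : ℕ} (hk : 14 ≤ k) (y : ℕ) :
    distortionLoss y (2 ^ (k + 1)) ≤ distortionLoss y (2 ^ k) +
      (∏ p ∈ (2 ^ (k + 1)).primesBelow, overlapFactor y p) / (7 * 2 ^ k) := by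
  set T := ∏ p ∈ (2 ^ (k + 1)).primesBelow, overlapFactor y p with hT
  have hT0 : 0 ≤ T := zero_le_one.trans (one_le_prod_overlapFactor y _)
  let f (p : ℕ) : ℝ :=
    if y ≤ p then (∏ r ∈ p.primesBelow, overlapFactor y r) / ((p : ℝ) - 1) ^ 2 else 0
  have hf (n : ℕ) : distortionLoss y n = ∑ p ∈ n.primesBelow, f p := sum_filter _ _
  rw [hf, hf, ← sum_filter_add_sum_filter_not _ (fun p => 2 ^ k ≤ p) f,
    filter_primesBelow_not_two_pow_le, add_comm]
  gcongr
  calc _ ≤ ∑ p ∈ dyadicPrimes k, T / (2 ^ k) ^ 2 := by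
        refine sum_le_sum fun p hp => ?_
        have h1 : (2 : ℝ) ^ k ≤ p - 1 := by
          have : (2 : ℝ) ^ k + 1 ≤ p := by
            exact_mod_cast two_pow_lt_of_mem_dyadicPrimes (by omega) hp
          linarith
        have h2 : ∏ r ∈ p.primesBelow, overlapFactor y r ≤ T :=
          prod_overlapFactor_mono y (Nat.lt_of_mem_primesBelow (mem_filter.mp hp).1).le
        dsimp only [f]
        split_ifs
        · gcongr
        · positivity
    _ ≤ 2 ^ k / 7 * (T / (2 ^ k) ^ 2) := by
        rw [sum_const, nsmul_eq_mul]
        exact mul_le_mul_of_nonneg_right (card_dyadicPrimes_le hk) (by positivity)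
    _ = T / (7 * 2 ^ k) := by field_simp

theorem distortionLoss_add_le {k : ℕ} (hk : 14 ≤ k) :
    distortionLoss (2 ^ 14) (2 ^ k) +
        16 / 7 * (∏ p ∈ (2 ^ k).primesBelow, overlapFactor (2 ^ 14) p) / 2 ^ k ≤
      16 / 7 * (∏ p ∈ (2 ^ 14).primesBelow, overlapFactor (2 ^ 14) p) / 2 ^ 14 := by
  induction k, hk using Nat.le_induction with
  | base => rw [distortionLoss_self, zero_add]
  | succ k hk ih =>
    refine le_trans ?_ ih
    have h1 := distortionLoss_two_pow_le hk (2 ^ 14)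
    have h2 := prod_overlapFactor_le (2 ^ 14) hk
    generalize ∏ p ∈ (2 ^ (k + 1)).primesBelow, overlapFactor (2 ^ 14) p = T' at *
    generalize ∏ p ∈ (2 ^ k).primesBelow, overlapFactor (2 ^ 14) p = T at *
    have h3 : T' / (7 * 2 ^ k) + 16 / 7 * T' / 2 ^ (k + 1) ≤ 16 / 7 * T / 2 ^ k := by
      have : T' / (7 * 2 ^ k) + 16 / 7 * T' / 2 ^ (k + 1) = 9 / 7 * T' / 2 ^ k := by
        rw [pow_succ]; field_simp; ring
      rw [this]
      gcongr ?_ / _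
      linarith
    linarith

/-- The completely multiplicative function `n ↦ n ^ (-s)`. -/
noncomputable def rpowNegHom (s : ℝ) : ℕ →* ℝ where
  toFun n := (n : ℝ) ^ (-s)
  map_one' := by simp
  map_mul' m n := by
    rw [Nat.cast_mul, Real.mul_rpow (Nat.cast_nonneg m) (Nat.cast_nonneg n)]

/-- **Rankin's trick** for the sum of reciprocals of large smooth numbers. -/
theorem sum_inv_le_of_dvd_smoothPart {S : Finset ℕ} {K : ℝ} (hK : 0 < K)
    (hS : ∀ m ∈ S, K ≤ (m : ℝ)) (Q y : ℕ) {s : ℝ} (hs0 : 0 < s) (hs1 : s ≤ 1) :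
    ∑ m ∈ S with m ∣ smoothPart Q y, (m : ℝ)⁻¹ ≤
      K ^ (s - 1) * ∏ p ∈ y.primesBelow, (1 - (p : ℝ) ^ (-s))⁻¹ := by
  have hf {p : ℕ} (hp : p.Prime) : ‖rpowNegHom s p‖ < 1 := by
    change ‖(p : ℝ) ^ (-s)‖ < 1
    rw [Real.norm_of_nonneg (by positivity)]
    exact Real.rpow_lt_one_of_one_lt_of_neg (by exact_mod_cast hp.one_lt) (by linarith)
  obtain ⟨hsum, hprod⟩ :=
    EulerProduct.summable_and_hasSum_smoothNumbers_prod_primesBelow_geometric hf y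
  have hmem : ∀ m ∈ S.filter (· ∣ smoothPart Q y), m ∈ Nat.smoothNumbers y := fun m hm => by
    rw [mem_filter] at hm
    refine Nat.mem_smoothNumbers_of_dvd (m := smoothPart Q y) ?_ hm.2
    exact Nat.mem_smoothNumbers'.mpr fun p hp hd =>
      lt_of_prime_of_dvd_smoothPart hp hd
  calc ∑ m ∈ S with m ∣ smoothPart Q y, (m : ℝ)⁻¹
      ≤ ∑ m ∈ S with m ∣ smoothPart Q y, K ^ (s - 1) * (m : ℝ) ^ (-s) := by
        refine sum_le_sum fun m hm => ?_
        have hKm := hS m (mem_filter.mp hm).1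
        have hm0 : (0 : ℝ) < m := hK.trans_le hKm
        calc (m : ℝ)⁻¹ = (m : ℝ) ^ (s - 1) * (m : ℝ) ^ (-s) := by
              rw [← Real.rpow_add hm0, ← Real.rpow_neg_one]
              ring_nf
          _ ≤ K ^ (s - 1) * (m : ℝ) ^ (-s) := by
              gcongr ?_ * _
              exact Real.rpow_le_rpow_of_nonpos hK hKm (by linarith)
    _ = K ^ (s - 1) * ∑ m ∈ S with m ∣ smoothPart Q y, (m : ℝ) ^ (-s) := by rw [mul_sum]
    _ ≤ K ^ (s - 1) * ∏ p ∈ y.primesBelow, (1 - (p : ℝ) ^ (-s))⁻¹ := by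
        gcongr
        rw [← sum_attach]
        have hinj : Function.Injective (fun m : {m // m ∈ S.filter (· ∣ smoothPart Q y)} =>
            (⟨m.1, hmem m.1 m.2⟩ : Nat.smoothNumbers y)) := fun m n h => by
          exact Subtype.ext (Subtype.mk.inj h)
        have := sum_le_hasSum (univ.map ⟨_, hinj⟩) (fun m _ => ?_) hprod
        · rw [sum_map] at this
          exact this
        · change 0 ≤ (m.1 : ℝ) ^ (-s)
          positivity

/-- Fixed-point arithmetic: a natural number `a` stands for the real number `a / fixedOne`. -/
def fixedOne : ℕ := 10 ^ 9

/-- `forced f x = f x`, but the argument is evaluated before it is substituted into `f`. -/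
def forced {α : Type} (f : ℕ → α) : ℕ → α
  | 0 => f 0
  | n + 1 => f (n + 1)

/-- A necessary condition for primality: each prime is at most `b` or coprime to `b !`. The second
entries are the products of the primes up to the first ones. -/
def passesSieve (n : ℕ) : Bool :=
  Nat.ble 2 n && [(3, 6), (10, 210), (127, 4014476939333036189094441199026045136645885247730)].all
    fun b => Nat.ble n b.1 || Nat.beq (Nat.gcd n b.2) 1

/-- A fixed-point upper bound for `∏ f p` over the primes `p` in `[a, a + 2 ^ k)`. -/
def fixedProd (f : ℕ → ℕ) : ℕ → ℕ → ℕ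
  | 0, a => forced (fun n => bif passesSieve n then f n else fixedOne) a
  | k + 1, a => fixedProd f k a * fixedProd f k (a + 2 ^ k) / fixedOne + 1

theorem forced_eq {α : Type} (f : ℕ → α) (n : ℕ) : forced f n = f n := by
  cases n <;> rfl

theorem passesSieve_of_prime {p : ℕ} (hp : p.Prime) : passesSieve p = true := by
  rw [passesSieve, Bool.and_eq_true, List.all_eq_true]
  refine ⟨Nat.ble_eq.mpr hp.two_le, fun b hb => ?_⟩
  have hdvd : b.2 ∣ b.1.factorial := by
    revert b
    decide +kernel
  rw [Bool.or_eq_true, Nat.ble_eq, Nat.beq_eq, or_iff_not_imp_left, not_le]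
  exact fun h => (hp.coprime_factorial_of_lt h).coprime_dvd_right hdvd

theorem natCast_div_le_div_add_one (a : ℕ) {b : ℕ} (hb : 0 < b) :
    (a : ℝ) / b ≤ ((a / b + 1 : ℕ) : ℝ) := by
  rw [div_le_iff₀ (by exact_mod_cast hb), mul_comm]
  exact_mod_cast (Nat.lt_mul_div_succ a hb).le

theorem prod_le_fixedProd {f : ℕ → ℕ} {g : ℕ → ℝ} (hg : ∀ p : ℕ, p.Prime → 0 ≤ g p)
    (hf : ∀ n, 2 ≤ n → fixedOne ≤ f n)
    (hgf : ∀ p : ℕ, p.Prime → g p ≤ (f p : ℝ) / fixedOne) (k a : ℕ) :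
    ∏ p ∈ Ico a (a + 2 ^ k) with p.Prime, g p ≤ (fixedProd f k a : ℝ) / fixedOne := by
  have h0 : (0 : ℝ) < fixedOne := by norm_num [fixedOne]
  induction k generalizing a with
  | zero =>
    rw [fixedProd, forced_eq, pow_zero, Nat.Ico_succ_singleton, prod_filter, prod_singleton]
    split_ifs with hp
    · rw [passesSieve_of_prime hp]
      exact hgf a hp
    · rw [le_div_iff₀ h0, one_mul, Nat.cast_le]
      by_cases h : passesSieve a = true
      · rw [h]
        rw [passesSieve, Bool.and_eq_true] at h
        exact hf a (Nat.ble_eq.mp h.1)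
      · rw [Bool.not_eq_true] at h
        rw [h, cond_false]
  | succ k ih =>
    have h1 := ih a
    have h2 := ih (a + 2 ^ k)
    rw [add_assoc, ← two_mul, ← pow_succ'] at h2
    rw [prod_filter, ← prod_Ico_consecutive _ (Nat.le_add_right a (2 ^ k))
      (Nat.add_le_add_left (Nat.pow_le_pow_right two_pos k.le_succ) a), ← prod_filter,
      ← prod_filter, fixedProd]
    have h3 : (0 : ℝ) ≤ ∏ p ∈ Ico (a + 2 ^ k) (a + 2 ^ (k + 1)) with p.Prime, g p :=
      prod_nonneg fun p hp => hg p (mem_filter.mp hp).2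
    refine (mul_le_mul h1 h2 h3 (by positivity)).trans ?_
    rw [div_mul_div_comm, ← div_div]
    gcongr
    have := natCast_div_le_div_add_one (fixedProd f k a * fixedProd f k (a + 2 ^ k))
      (b := fixedOne) (by norm_num [fixedOne])
    rwa [Nat.cast_mul] at this

theorem prod_primesBelow_two_pow_le {f : ℕ → ℕ} {g : ℕ → ℝ} (hg : ∀ p : ℕ, p.Prime → 0 ≤ g p)
    (hf : ∀ n, 2 ≤ n → fixedOne ≤ f n)
    (hgf : ∀ p : ℕ, p.Prime → g p ≤ (f p : ℝ) / fixedOne) (k : ℕ) :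
    ∏ p ∈ (2 ^ k).primesBelow, g p ≤ (fixedProd f k 0 : ℝ) / fixedOne := by
  have := prod_le_fixedProd hg hf hgf k 0
  rwa [zero_add, ← range_eq_Ico] at this

/-- A fixed-point upper bound for `overlapFactor y p` when `p < y`. -/
def fixedOverlapFactor (n : ℕ) : ℕ :=
  fixedOne + ((3 * n - 1) * fixedOne / (n - 1) ^ 2 + 1)

theorem fixedProd_fixedOverlapFactor_le :
    fixedProd fixedOverlapFactor 14 0 ≤ 3500 * fixedOne := by
  decide +kernel

theorem prod_overlapFactor_self (y : ℕ) : ∏ p ∈ y.primesBelow, overlapFactor y p =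
    ∏ p ∈ y.primesBelow, (1 + (3 * p - 1) / ((p : ℝ) - 1) ^ 2) :=
  prod_congr rfl fun p hp => by
    rw [overlapFactor, if_neg (Nat.lt_of_mem_primesBelow hp).not_ge, one_mul]

theorem prod_overlapFactor_two_pow_fourteen_le :
    ∏ p ∈ (2 ^ 14).primesBelow, overlapFactor (2 ^ 14) p ≤ 3500 := by
  have h0 : (0 : ℝ) < fixedOne := by norm_num [fixedOne]
  rw [prod_overlapFactor_self]
  refine (prod_primesBelow_two_pow_le (f := fixedOverlapFactor) (fun p hp => ?_) (fun n _ => ?_)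
    (fun p hp => ?_) 14).trans ?_
  · have : (1 : ℝ) ≤ p := by exact_mod_cast hp.one_le
    have : (0 : ℝ) ≤ 3 * p - 1 := by linarith
    positivity
  · exact Nat.le_add_right _ _
  · have h2 := natCast_div_le_div_add_one ((3 * p - 1) * fixedOne) (b := (p - 1) ^ 2)
      (pow_pos (Nat.sub_pos_of_lt hp.one_lt) 2)
    have h3 : 1 ≤ 3 * p := by have := hp.one_le; omega
    rw [fixedOverlapFactor, Nat.cast_add, add_div, div_self h0.ne']
    refine add_le_add_right ((le_div_iff₀ h0).mpr (le_trans (le_of_eq ?_) h2)) 1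
    push_cast [hp.one_le, h3]
    ring
  · rw [div_le_iff₀ h0]
    exact_mod_cast fixedProd_fixedOverlapFactor_le

/-- Newton's iteration for the fourth root of `N`. -/
def fourthRootIter (N : ℕ) : ℕ → ℕ → ℕ
  | 0, t => t
  | k + 1, t => forced (fourthRootIter N k) ((3 * t + N / t ^ 3) / 4)

/-- A fixed-point upper bound for `(1 - p ^ (-3 / 4))⁻¹`, given a lower approximation `t` to
`10 ^ 4 * p ^ (3 / 4)`; falls back to a trivial bound if `t` is not such an approximation. -/
def fixedEulerFactorOfRoot (p t : ℕ) : ℕ :=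
  bif Nat.ble (t ^ 4) (p ^ 3 * 10 ^ 16) && Nat.ble (10 ^ 4 + 1) t then
    t * fixedOne / (t - 10 ^ 4) + 1
  else 10 * fixedOne

/-- A fixed-point upper bound for `(1 - p ^ (-3 / 4))⁻¹`. Newton's iteration starts between one and
two times the root when `p < 2 ^ 16`. -/
def fixedEulerFactor (p : ℕ) : ℕ :=
  forced (fixedEulerFactorOfRoot p)
    (forced (fun N => fourthRootIter N 7) (p ^ 3 * 10 ^ 16)
      (bif Nat.ble 4096 p then 1250 * p else bif Nat.ble 256 p then 2500 * p
        else bif Nat.ble 16 p then 5000 * p else 10000 * p) - 1)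

theorem fixedProd_fixedEulerFactor_le :
    fixedProd fixedEulerFactor 14 0 ≤ 3400 * fixedOne := by
  decide +kernel

theorem fixedOne_le_fixedEulerFactorOfRoot (p t : ℕ) : fixedOne ≤ fixedEulerFactorOfRoot p t := by
  unfold fixedEulerFactorOfRoot
  cases h : Nat.ble (t ^ 4) (p ^ 3 * 10 ^ 16) && Nat.ble (10 ^ 4 + 1) t
  · rw [cond_false]
    exact Nat.le_mul_of_pos_left _ (by norm_num)
  · rw [Bool.and_eq_true, Nat.ble_eq, Nat.ble_eq] at h
    rw [cond_true]
    refine Nat.le_succ_of_le ((Nat.le_div_iff_mul_le (by omega)).mpr ?_)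
    rw [mul_comm]
    exact Nat.mul_le_mul_right _ (Nat.sub_le _ _)

theorem inv_one_sub_rpow_le {p t : ℕ} (ht : t ^ 4 ≤ p ^ 3 * 10 ^ 16) (ht' : 10 ^ 4 < t) :
    (1 - (p : ℝ) ^ (-(3 / 4 : ℝ)))⁻¹ ≤ t / ((t : ℝ) - 10 ^ 4) := by
  have ht0 : (10 : ℝ) ^ 4 < t := by exact_mod_cast ht'
  have h1 : (t : ℝ) / 10 ^ 4 ≤ (p : ℝ) ^ (3 / 4 : ℝ) := by
    refine le_of_pow_le_pow_left₀ (n := 4) (by norm_num) (by positivity) ?_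
    have h2 : ((p : ℝ) ^ (3 / 4 : ℝ)) ^ 4 = (p : ℝ) ^ 3 := by
      rw [← Real.rpow_natCast, ← Real.rpow_mul (Nat.cast_nonneg p), ← Real.rpow_natCast]
      norm_num
    rw [h2, div_pow, div_le_iff₀ (by positivity)]
    norm_num
    exact_mod_cast ht
  have h2 : (p : ℝ) ^ (-(3 / 4 : ℝ)) ≤ 10 ^ 4 / t := by
    rw [Real.rpow_neg (Nat.cast_nonneg p), ← inv_div (t : ℝ)]
    exact inv_anti₀ (by positivity) h1
  have h3 : (0 : ℝ) < t - 10 ^ 4 := by linarith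
  have h4 : (0 : ℝ) < t := by linarith
  rw [← inv_div ((t : ℝ) - 10 ^ 4)]
  refine inv_anti₀ (div_pos h3 h4) ?_
  rw [sub_div, div_self h4.ne']
  linarith

theorem inv_one_sub_rpow_le_fixedEulerFactorOfRoot {p : ℕ} (hp : p.Prime) (t : ℕ) :
    (1 - (p : ℝ) ^ (-(3 / 4 : ℝ)))⁻¹ ≤ fixedEulerFactorOfRoot p t / fixedOne := by
  have h0 : (0 : ℝ) < fixedOne := by norm_num [fixedOne]
  unfold fixedEulerFactorOfRoot
  cases h : Nat.ble (t ^ 4) (p ^ 3 * 10 ^ 16) && Nat.ble (10 ^ 4 + 1) t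
  · have h1 : (11112 : ℕ) ^ 4 ≤ p ^ 3 * 10 ^ 16 :=
      le_trans (by norm_num) (Nat.mul_le_mul_right _ (Nat.pow_le_pow_left hp.two_le 3))
    refine (inv_one_sub_rpow_le h1 (by norm_num)).trans ?_
    rw [le_div_iff₀ h0, cond_false, Nat.cast_mul]
    gcongr
    norm_num
  · rw [Bool.and_eq_true, Nat.ble_eq, Nat.ble_eq] at h
    refine (inv_one_sub_rpow_le h.1 h.2).trans ?_
    have h1 := natCast_div_le_div_add_one (t * fixedOne) (b := t - 10 ^ 4) (by omega)
    rw [le_div_iff₀ h0, cond_true]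
    refine le_trans (le_of_eq ?_) h1
    rw [Nat.cast_sub (by omega)]
    push_cast
    ring

theorem prod_inv_one_sub_rpow_le :
    ∏ p ∈ Nat.primesBelow (2 ^ 14), (1 - (p : ℝ) ^ (-(3 / 4 : ℝ)))⁻¹ ≤ 3400 := by
  have h0 : (0 : ℝ) < fixedOne := by norm_num [fixedOne]
  refine (prod_primesBelow_two_pow_le (f := fixedEulerFactor) (fun p hp => ?_) (fun n _ => ?_)
    (fun p hp => ?_) 14).trans ?_
  · have := Real.rpow_le_one_of_one_le_of_nonpos (x := p) (z := -(3 / 4 : ℝ))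
      (by exact_mod_cast hp.one_le) (by norm_num)
    exact inv_nonneg.mpr (sub_nonneg.mpr this)
  · rw [fixedEulerFactor, forced_eq]
    exact fixedOne_le_fixedEulerFactorOfRoot _ _
  · rw [fixedEulerFactor, forced_eq]
    exact inv_one_sub_rpow_le_fixedEulerFactorOfRoot hp _
  · rw [div_le_iff₀ h0]
    exact_mod_cast fixedProd_fixedEulerFactor_le

end

/-- **Hough's theorem.** Every covering system of the integers with distinct moduli
has a modulus at most `10 ^ 16`. -/
theorem covering_min_modulus_le
    (S : Finset ℕ) (hS : ∀ m ∈ S, 1 < m) (a : ℕ → ℤ)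
    (hcov : ∀ n : ℤ, ∃ m ∈ S, n ≡ a m [ZMOD (m : ℤ)]) :
    ∃ m ∈ S, m ≤ 10 ^ 16 := by
  by_contra! h
  obtain ⟨Q, n₀, hn₀⟩ := one_le_of_covering (fun m hm => (zero_lt_one.trans (hS m hm)).ne') hcov
    (2 ^ 14)
  have h1 := hn₀ (2 ^ (14 + n₀)) ((Nat.le_add_left _ _).trans Nat.lt_two_pow_self.le)
  have h2 := sum_inv_le_of_dvd_smoothPart (S := S) (K := 10 ^ 16) (by norm_num)
    (fun m hm => by exact_mod_cast (h m hm).le) Q (2 ^ 14) (s := 3 / 4) (by norm_num) (by norm_num)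
  have h3 : ((10 : ℝ) ^ 16) ^ (3 / 4 - 1 : ℝ) = 1 / 10 ^ 4 := by
    rw [← Real.rpow_natCast, ← Real.rpow_mul (by norm_num)]
    norm_num [← Real.rpow_natCast, Real.rpow_neg]
  rw [h3] at h2
  have h4 := distortionLoss_add_le (k := 14 + n₀) (Nat.le_add_right _ _)
  have h5 : (0 : ℝ) ≤ 16 / 7 * (∏ p ∈ (2 ^ (14 + n₀)).primesBelow, overlapFactor (2 ^ 14) p) /
      2 ^ (14 + n₀) := by
    have := one_le_prod_overlapFactor (2 ^ 14) (2 ^ (14 + n₀))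
    positivity
  have h6 := prod_overlapFactor_two_pow_fourteen_le
  have h7 := prod_inv_one_sub_rpow_le
  have h8 : 16 / 7 * (∏ p ∈ (2 ^ 14).primesBelow, overlapFactor (2 ^ 14) p) / 2 ^ 14 ≤
      (16 / 7 * 3500 / 2 ^ 14 : ℝ) := by gcongr
  norm_num at h1 h2 h4 h5 h7 h8
  linarith
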